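/- Fix λ > 1, r > 0, T > 0. For every s < −1, p > 1 and ε > 0 there exists a constant C_ε > 0, not depending on N, such that for every integer N ≥ 1 and every N-finite random solution (Ω, F, P, U) with parameter r: P( ω : ( ∫_0^T ( ‖U(ω,t)‖_{H^s}^p + ‖∂_t U(ω,t)‖_{H^s}^p ) dt )^{1/p} ≤ C_ε ) > 1 − ε, where ∂_t U(ω,t) denotes the sequence whose n-th entry is the time derivative of U_n(ω,·) at t for n ≤ N and 0 for n > N. -/

import Mathlib

open MeasureTheory ProbabilityTheory

/-- Coefficients of the N-dimensional shell model. -/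
noncomputable def shellK (lam : ℝ) (N : ℕ) (n : ℕ) : ℝ :=
  if 1 < n ∧ n < N then lam ^ n else 0

/-- A solution of the `N`-dimensional shell model on `[0,T]`, conventions `X_0 ≡ 0`,
`X_{N+1} ≡ 0`. -/
def IsShellSolution (lam : ℝ) (N : ℕ) (T : ℝ) (X : ℝ → ℕ → ℝ) : Prop :=
  (∀ t, X t 0 = 0) ∧ (∀ t, X t (N + 1) = 0) ∧
  ∀ n, 1 ≤ n → n ≤ N → ∀ t ∈ Set.Icc (0 : ℝ) T,
    HasDerivWithinAt (fun u => X u n)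
      (shellK lam N n * (X t (n - 1)) ^ 2
        - shellK lam N (n + 1) * X t n * X t (n + 1)
        - shellK lam N n * (X t (n + 1)) ^ 2
        + shellK lam N (n - 1) * X t (n - 1) * X t n)
      (Set.Icc (0 : ℝ) T) t

/-- An `N`-finite random solution with parameter `r > 0`. -/
def IsNFiniteRandomSolution (lam T r : ℝ) (N : ℕ) {Ω : Type*} [MeasurableSpace Ω]
    (P : Measure Ω) (U : Ω → ℝ → ℕ → ℝ) : Prop :=
  Measurable (fun p : Ω × ℝ => U p.1 p.2) ∧
  (∀ ω t, ∀ n, N < n → U ω t n = 0) ∧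
  (∀ ω, IsShellSolution lam N T (U ω)) ∧
  Measure.map (fun ω => fun i : Fin N => U ω 0 ((i : ℕ) + 1)) P
    = Measure.pi fun _ : Fin N => gaussianReal 0 (r ^ 2).toNNReal

/-- The `H^s` norm of a sequence (component `n ≥ 1` is `x n`):
`‖x‖_{H^s} = ( ∑_{n≥1} λ^{2sn} x_n² )^{1/2}`. -/
noncomputable def Hnorm (lam s : ℝ) (x : ℕ → ℝ) : ℝ :=
  Real.sqrt (∑' n : ℕ, lam ^ (2 * s * ((n : ℝ) + 1)) * (x (n + 1)) ^ 2)

/-- The time derivative `∂_t U(t)` of a path, as a sequence: the `n`-th entry is the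
derivative (within `[0,T]`) of `U_n` at `t` for `1 ≤ n ≤ N`, and `0` for `n > N`. -/
noncomputable def timeDeriv (T : ℝ) (N : ℕ) (U : ℝ → ℕ → ℝ) (t : ℝ) : ℕ → ℝ :=
  fun n =>
    if 1 ≤ n ∧ n ≤ N then derivWithin (fun u => U u n) (Set.Icc (0 : ℝ) T) t else 0

/-- `MonomialBound d c φ`: `φ` is built from constants, variables and sums with total degree at most
`d` and sum of absolute values of coefficients at most `c`. -/
inductive MonomialBound {ι : Type*} : ℕ → ℝ → MvPolynomial ι ℝ → Prop
  | const (d : ℕ) (c a : ℝ) (h : |a| ≤ c) : MonomialBound d c (MvPolynomial.C a)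
  | mul_X (d : ℕ) (c : ℝ) (φ : MvPolynomial ι ℝ) (i : ι) (h : MonomialBound d c φ) :
      MonomialBound (d + 1) c (φ * MvPolynomial.X i)
  | add (d : ℕ) (c c' : ℝ) (φ ψ : MvPolynomial ι ℝ) (h : MonomialBound d c φ)
      (h' : MonomialBound d c' ψ) : MonomialBound d (c + c') (φ + ψ)

namespace MonomialBound

variable {ι : Type*} {d e : ℕ} {c c' : ℝ} {φ ψ : MvPolynomial ι ℝ}

theorem nonneg (h : MonomialBound d c φ) : 0 ≤ c := by
  induction h with
  | const d c a h => exact (abs_nonneg a).trans h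
  | mul_X => assumption
  | add => linarith

theorem mono_const (h : MonomialBound d c φ) (hc : c ≤ c') : MonomialBound d c' φ := by
  have := add d c (c' - c) φ (MvPolynomial.C 0) h (const _ _ _ (by simpa using hc))
  simpa using this

theorem mono_degree (h : MonomialBound d c φ) (hd : d ≤ e) : MonomialBound e c φ := by
  induction h generalizing e with
  | const d c a h => exact const _ _ _ h
  | mul_X d c φ i h ih =>
    obtain ⟨e, rfl⟩ : ∃ e', e = e' + 1 := ⟨e - 1, by omega⟩
    exact mul_X _ _ _ _ (ih (by omega))
  | add d c c' φ ψ h h' ih ih' => exact add _ _ _ _ _ (ih hd) (ih' hd)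

theorem const_mul (h : MonomialBound d c φ) (a : ℝ) :
    MonomialBound d (c * |a|) (φ * MvPolynomial.C a) := by
  induction h with
  | const d c b h =>
    rw [← map_mul]
    refine const _ _ _ ?_
    rw [abs_mul]
    gcongr
  | mul_X d c φ i h ih => rw [mul_right_comm]; exact mul_X _ _ _ _ ih
  | add d c c' φ ψ h h' ih ih' => rw [add_mul, add_mul]; exact add _ _ _ _ _ ih ih'

theorem mul (h : MonomialBound d c φ) (h' : MonomialBound e c' ψ) :
    MonomialBound (d + e) (c * c') (φ * ψ) := by
  induction h' with
  | const e c' a h' =>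
    exact ((h.const_mul a).mono_degree (by omega)).mono_const (by gcongr; exact h.nonneg)
  | mul_X e c' ψ i h' ih => rw [← mul_assoc]; exact mul_X _ _ _ _ ih
  | add e c' c'' ψ ψ' h h' ih ih' => rw [mul_add, mul_add]; exact add _ _ _ _ _ ih ih'

theorem exists_bound (φ : MvPolynomial ι ℝ) : ∃ d c, MonomialBound d c φ := by
  induction φ using MvPolynomial.induction_on with
  | C a => exact ⟨0, _, const _ _ _ le_rfl⟩
  | add φ ψ h h' =>
    obtain ⟨d, c, h⟩ := h
    obtain ⟨e, c', h'⟩ := h'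
    exact ⟨_, _, add _ _ _ _ _ (h.mono_degree (le_max_left d e))
      (h'.mono_degree (le_max_right d e))⟩
  | mul_X φ i h =>
    obtain ⟨d, c, h⟩ := h
    exact ⟨_, _, mul_X _ _ _ _ h⟩

theorem abs_eval_le (h : MonomialBound d c φ) {R : ℝ} (hR : 1 ≤ R) {x : ι → ℝ}
    (hx : ∀ i, |x i| ≤ R) : |MvPolynomial.eval x φ| ≤ c * R ^ d := by
  induction h with
  | const d c a h =>
    rw [MvPolynomial.eval_C]
    exact h.trans (le_mul_of_one_le_right ((abs_nonneg a).trans h) (one_le_pow₀ hR))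
  | mul_X d c φ i h ih =>
    rw [map_mul, MvPolynomial.eval_X, abs_mul, pow_succ, ← mul_assoc]
    exact mul_le_mul ih (hx i) (abs_nonneg _) ((abs_nonneg _).trans ih)
  | add d c c' φ ψ h h' ih ih' =>
    rw [map_add, add_mul]
    exact (abs_add_le _ _).trans (add_le_add ih ih')

theorem mkDerivation {b : ι → MvPolynomial ι ℝ} {K : ℝ} (hK : 0 ≤ K)
    (hb : ∀ i, MonomialBound 2 K (b i)) (h : MonomialBound d c φ) :
    MonomialBound (d + 1) (d * K * c) (MvPolynomial.mkDerivation ℝ b φ) := by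
  induction h with
  | const d c a h =>
    rw [MvPolynomial.derivation_C, ← MvPolynomial.C_0]
    refine const _ _ _ ?_
    have := (abs_nonneg a).trans h
    rw [abs_zero]; positivity
  | mul_X d c φ i h ih =>
    rw [Derivation.leibniz, MvPolynomial.mkDerivation_X, smul_eq_mul, smul_eq_mul,
      mul_comm (MvPolynomial.X i)]
    refine (add _ _ _ _ _ (h.mul (hb i)) (mul_X _ _ _ i ih)).mono_const ?_
    push_cast
    exact le_of_eq (by ring)
  | add d c c' φ ψ h h' ih ih' =>
    rw [map_add, mul_add]; exact add _ _ _ _ _ ih ih'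

theorem iterate_mkDerivation {b : ι → MvPolynomial ι ℝ} {K : ℝ} (hK : 0 ≤ K)
    (hb : ∀ i, MonomialBound 2 K (b i)) (h : MonomialBound (d + 1) c φ) (k : ℕ) :
    MonomialBound (d + 1 + k) ((d + 1).ascFactorial k * K ^ k * c)
      ((MvPolynomial.mkDerivation ℝ b)^[k] φ) := by
  induction k with
  | zero => simpa using h
  | succ k ih =>
    rw [Function.iterate_succ_apply']
    refine (ih.mkDerivation hK hb).mono_const (le_of_eq ?_)
    rw [Nat.ascFactorial_succ]
    push_cast
    ring

end MonomialBound

section flow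

variable {ι : Type*} {b : ι → MvPolynomial ι ℝ} {T : ℝ} {x : ℝ → ι → ℝ}

theorem hasDerivWithinAt_eval_mvPolynomial {s : Set ℝ} {t : ℝ}
    (hx : ∀ i, HasDerivWithinAt (fun u => x u i) (MvPolynomial.eval (x t) (b i)) s t)
    (φ : MvPolynomial ι ℝ) :
    HasDerivWithinAt (fun u => MvPolynomial.eval (x u) φ)
      (MvPolynomial.eval (x t) (MvPolynomial.mkDerivation ℝ b φ)) s t := by
  induction φ using MvPolynomial.induction_on with
  | C a => simpa using hasDerivWithinAt_const t s a
  | add φ ψ h h' => simpa using h.fun_add h'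
  | mul_X φ i h =>
    simp only [map_mul, MvPolynomial.eval_X, Derivation.leibniz, MvPolynomial.mkDerivation_X,
      smul_eq_mul, map_add]
    refine (h.fun_mul (hx i)).congr_deriv ?_
    ring

/-- Taylor's estimate for a polynomial observable along a polynomial flow. -/
theorem abs_eval_sub_taylor_le {a h M : ℝ}
    (hx : ∀ i, ∀ t ∈ Set.Icc a (a + h), HasDerivWithinAt (fun u => x u i)
      (MvPolynomial.eval (x t) (b i)) (Set.Icc a (a + h)) t)
    (k : ℕ) (φ : MvPolynomial ι ℝ)
    (hM : ∀ t ∈ Set.Icc a (a + h),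
      |MvPolynomial.eval (x t) ((MvPolynomial.mkDerivation ℝ b)^[k] φ)| ≤ M) :
    ∀ t ∈ Set.Icc a (a + h),
      |MvPolynomial.eval (x t) φ - ∑ j ∈ Finset.range k,
        MvPolynomial.eval (x a) ((MvPolynomial.mkDerivation ℝ b)^[j] φ) * (t - a) ^ j / j.factorial|
      ≤ M * (t - a) ^ k / k.factorial := by
  induction k generalizing φ with
  | zero => simpa using hM
  | succ k ih =>
    specialize ih (MvPolynomial.mkDerivation ℝ b φ) hM
    have hderiv : ∀ t ∈ Set.Icc a (a + h), HasDerivWithinAt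
      (fun t => MvPolynomial.eval (x t) φ - ∑ j ∈ Finset.range (k + 1),
        MvPolynomial.eval (x a) ((MvPolynomial.mkDerivation ℝ b)^[j] φ) * (t - a) ^ j / j.factorial)
      (MvPolynomial.eval (x t) (MvPolynomial.mkDerivation ℝ b φ) - ∑ j ∈ Finset.range k,
        MvPolynomial.eval (x a)
          ((MvPolynomial.mkDerivation ℝ b)^[j] (MvPolynomial.mkDerivation ℝ b φ))
            * (t - a) ^ j / j.factorial) (Set.Icc a (a + h)) t := by
      intro t ht
      refine (hasDerivWithinAt_eval_mvPolynomial (fun i => hx i t ht) φ).fun_sub ?_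
      simp only [Finset.sum_range_succ' _ k, pow_zero]
      refine HasDerivWithinAt.add_const _ (HasDerivWithinAt.fun_sum fun j _ => ?_)
      rw [Function.iterate_succ_apply]
      have h1 := ((((hasDerivAt_id t).sub_const a).fun_pow (j + 1)).const_mul
        (MvPolynomial.eval (x a)
          ((MvPolynomial.mkDerivation ℝ b)^[j] (MvPolynomial.mkDerivation ℝ b φ)))).div_const
          ((j + 1).factorial : ℝ)
      refine (h1.hasDerivWithinAt (s := Set.Icc a (a + h))).congr_deriv ?_
      rw [Nat.factorial_succ]
      have : (j.factorial : ℝ) ≠ 0 := by positivity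
      push_cast
      simp
      field_simp
    have hB : ∀ t : ℝ, HasDerivAt (fun t => M * (t - a) ^ (k + 1) / (k + 1).factorial)
        (M * (t - a) ^ k / k.factorial) t := by
      intro t
      have h1 := ((((hasDerivAt_id t).sub_const a).fun_pow (k + 1)).const_mul M).div_const
        ((k + 1).factorial : ℝ)
      refine h1.congr_deriv ?_
      rw [Nat.factorial_succ]
      have : (k.factorial : ℝ) ≠ 0 := by positivity
      push_cast
      simp
      field_simp
    intro t ht
    have := image_norm_le_of_norm_deriv_right_le_deriv_boundary
      (fun t ht => (hderiv t ht).continuousWithinAt)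
      (fun t ht => (hderiv t (Set.Ico_subset_Icc_self ht)).mono_of_mem_nhdsWithin
        (Icc_mem_nhdsGE_of_mem ht))
      (B := fun t => M * (t - a) ^ (k + 1) / (k + 1).factorial) ?_ hB
      (fun t ht => ih t (Set.Ico_subset_Icc_self ht)) ht
    · exact this
    · rw [Finset.sum_range_succ']; simp

theorem integral_eval_flow_step [Countable ι] {Ω : Type*} [MeasurableSpace Ω] {P : Measure Ω}
    [IsProbabilityMeasure P] {X : Ω → ℝ → ι → ℝ} {G : Ω → ℝ} {K R a h : ℝ} (hK : 0 ≤ K)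
    (hb : ∀ i, MonomialBound 2 K (b i)) (hh : 0 ≤ h) (hR : 1 ≤ R) (hKR : 2 * K * R * h < 1)
    (hX : ∀ ω i, ∀ t ∈ Set.Icc a (a + h), HasDerivWithinAt (fun u => X ω u i)
      (MvPolynomial.eval (X ω t) (b i)) (Set.Icc a (a + h)) t)
    (hXm : ∀ t ∈ Set.Icc a (a + h), Measurable fun ω => X ω t) (hG : Measurable G)
    (hG1 : ∀ ω, |G ω| ≤ 1)
    (hGR : ∀ ω, G ω ≠ 0 → ∀ t ∈ Set.Icc a (a + h), ∀ i, |X ω t i| ≤ R)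
    (h0 : ∀ ψ, ∫ ω, MvPolynomial.eval (X ω a) (MvPolynomial.mkDerivation ℝ b ψ) * G ω ∂P = 0)
    (φ : MvPolynomial ι ℝ) :
    ∫ ω, MvPolynomial.eval (X ω (a + h)) φ * G ω ∂P
      = ∫ ω, MvPolynomial.eval (X ω a) φ * G ω ∂P := by
  obtain ⟨d, c, hd⟩ := MonomialBound.exists_bound φ
  have hc := hd.nonneg
  have ha : a ∈ Set.Icc a (a + h) := ⟨le_rfl, by linarith⟩
  have hah : a + h ∈ Set.Icc a (a + h) := ⟨by linarith, le_rfl⟩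
  have hInt : ∀ t ∈ Set.Icc a (a + h), ∀ ψ : MvPolynomial ι ℝ,
      Integrable (fun ω => MvPolynomial.eval (X ω t) ψ * G ω) P := by
    intro t ht ψ
    obtain ⟨e, c', he⟩ := MonomialBound.exists_bound ψ
    refine Integrable.of_bound (C := c' * R ^ e) ?_ (ae_of_all _ fun ω => ?_)
    · exact (((MvPolynomial.continuous_eval ψ).measurable.comp (hXm t ht)).mul
        hG).aestronglyMeasurable
    · have : 0 ≤ c' := he.nonneg
      by_cases hω : G ω = 0
      · rw [hω, mul_zero, norm_zero]; positivity
      · rw [Real.norm_eq_abs, abs_mul, ← mul_one (c' * R ^ e)]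
        exact mul_le_mul (he.abs_eval_le hR (hGR ω hω t ht)) (hG1 ω) (abs_nonneg _) (by positivity)
  have key : ∀ k : ℕ, |∫ ω, MvPolynomial.eval (X ω (a + h)) φ * G ω ∂P
      - ∫ ω, MvPolynomial.eval (X ω a) φ * G ω ∂P|
      ≤ 2 ^ d * c * R ^ (d + 1) * (2 * K * R * h) ^ (k + 1) := by
    intro k
    have hsum : ∫ ω, (∑ j ∈ Finset.range (k + 1),
        MvPolynomial.eval (X ω a) ((MvPolynomial.mkDerivation ℝ b)^[j] φ) * h ^ j / j.factorial)
          * G ω ∂P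
        = ∫ ω, MvPolynomial.eval (X ω a) φ * G ω ∂P := by
      have : ∀ j ω, MvPolynomial.eval (X ω a) ((MvPolynomial.mkDerivation ℝ b)^[j] φ)
          * h ^ j / j.factorial * G ω
          = MvPolynomial.eval (X ω a) ((MvPolynomial.mkDerivation ℝ b)^[j] φ) * G ω
            * (h ^ j / j.factorial) := by
        intros; ring
      simp_rw [Finset.sum_mul, this]
      rw [integral_finsetSum _ fun j _ => (hInt a ha _).mul_const _]
      simp_rw [integral_mul_const]
      rw [Finset.sum_range_succ']
      simp [Function.iterate_succ_apply', h0]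
    have hsi : Integrable (fun ω => (∑ j ∈ Finset.range (k + 1),
        MvPolynomial.eval (X ω a) ((MvPolynomial.mkDerivation ℝ b)^[j] φ) * h ^ j / j.factorial)
          * G ω) P := by
      simp_rw [Finset.sum_mul]
      refine integrable_finsetSum _ fun j _ => ?_
      refine ((hInt a ha ((MvPolynomial.mkDerivation ℝ b)^[j] φ)).mul_const
        (h ^ j / j.factorial)).congr
        (ae_of_all _ fun ω => ?_)
      ring
    rw [← hsum, ← integral_sub (hInt _ hah _) hsi]
    rw [← Real.norm_eq_abs]
    refine (norm_integral_le_of_norm_le_const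
      (C := 2 ^ d * c * R ^ (d + 1) * (2 * K * R * h) ^ (k + 1))
      (ae_of_all _ fun ω => ?_)).trans (by simp)
    rw [← sub_mul, Real.norm_eq_abs, abs_mul]
    by_cases hω : G ω = 0
    · rw [hω, abs_zero, mul_zero]; positivity
    have hM := abs_eval_sub_taylor_le (hX ω) (k + 1) φ (fun t ht =>
      ((hd.mono_degree (Nat.le_succ d)).iterate_mkDerivation hK hb (k + 1)).abs_eval_le hR
        (hGR ω hω t ht)) _ hah
    rw [add_sub_cancel_left] at hM
    refine (mul_le_of_le_one_right (abs_nonneg _) (hG1 ω)).trans (hM.trans ?_)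
    rw [Nat.ascFactorial_eq_factorial_mul_choose]
    have h2 : ((d + (k + 1)).choose (k + 1) : ℝ) ≤ 2 ^ (d + (k + 1)) := by
      exact_mod_cast Nat.choose_le_two_pow _ _
    have h3 : ((k + 1).factorial : ℝ) ≠ 0 := by positivity
    calc _ = ((d + (k + 1)).choose (k + 1) : ℝ)
          * (K ^ (k + 1) * c * R ^ (d + 1 + (k + 1)) * h ^ (k + 1)) := by
          push_cast; field_simp
      _ ≤ 2 ^ (d + (k + 1)) * (K ^ (k + 1) * c * R ^ (d + 1 + (k + 1)) * h ^ (k + 1)) := by gcongr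
      _ = _ := by ring
  have hlim : Filter.Tendsto (fun k : ℕ => 2 ^ d * c * R ^ (d + 1) * (2 * K * R * h) ^ (k + 1))
      Filter.atTop (nhds 0) := by
    have := ((tendsto_pow_atTop_nhds_zero_of_lt_one (by positivity) hKR).comp
      (Filter.tendsto_add_atTop_nat 1)).const_mul (2 ^ d * c * R ^ (d + 1))
    simpa using this
  have := ge_of_tendsto' hlim key
  exact sub_eq_zero.1 (abs_nonpos_iff.1 this)

/-- A weight on the initial data which annihilates all Lie derivatives of polynomials, and which
restricts to trajectories in a fixed box, is invariant under a quadratic polynomial flow. -/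
theorem integral_eval_flow_eq [Countable ι] {Ω : Type*} [MeasurableSpace Ω] {P : Measure Ω}
    [IsProbabilityMeasure P] {X : Ω → ℝ → ι → ℝ} {G : Ω → ℝ} {K R : ℝ} (hK : 0 ≤ K)
    (hb : ∀ i, MonomialBound 2 K (b i)) (hR : 1 ≤ R)
    (hX : ∀ ω i, ∀ t ∈ Set.Icc 0 T, HasDerivWithinAt (fun u => X ω u i)
      (MvPolynomial.eval (X ω t) (b i)) (Set.Icc 0 T) t)
    (hXm : ∀ t ∈ Set.Icc 0 T, Measurable fun ω => X ω t) (hG : Measurable G)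
    (hG1 : ∀ ω, |G ω| ≤ 1)
    (hGR : ∀ ω, G ω ≠ 0 → ∀ t ∈ Set.Icc 0 T, ∀ i, |X ω t i| ≤ R)
    (h0 : ∀ ψ, ∫ ω, MvPolynomial.eval (X ω 0) (MvPolynomial.mkDerivation ℝ b ψ) * G ω ∂P = 0)
    {t : ℝ} (ht : t ∈ Set.Icc 0 T) (φ : MvPolynomial ι ℝ) :
    ∫ ω, MvPolynomial.eval (X ω t) φ * G ω ∂P
      = ∫ ω, MvPolynomial.eval (X ω 0) φ * G ω ∂P := by
  obtain ⟨n, hn⟩ := exists_nat_gt (2 * K * R * t)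
  have hn0 : (0 : ℝ) < n := lt_of_le_of_lt (by have := ht.1; positivity) hn
  set h := t / n with hdef
  have hh : 0 ≤ h := div_nonneg ht.1 hn0.le
  have hnh : n * h = t := by rw [hdef]; field_simp
  have key : ∀ k : ℕ, k ≤ n → ∀ φ, ∫ ω, MvPolynomial.eval (X ω (k * h)) φ * G ω ∂P
      = ∫ ω, MvPolynomial.eval (X ω 0) φ * G ω ∂P := by
    intro k
    induction k with
    | zero => simp
    | succ k ih =>
      intro hk φ
      specialize ih (by omega)
      have hle : (k : ℝ) * h + h ≤ t := by
        rw [← hnh, ← add_one_mul]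
        gcongr
        exact_mod_cast hk
      have hsub : Set.Icc (k * h) (k * h + h) ⊆ Set.Icc 0 T :=
        Set.Icc_subset_Icc (by positivity) (hle.trans ht.2)
      rw [Nat.cast_succ, add_one_mul, ← ih φ]
      refine integral_eval_flow_step hK hb hh hR ?_
        (fun ω i t ht => (hX ω i t (hsub ht)).mono hsub) (fun t ht => hXm t (hsub ht)) hG hG1
        (fun ω hω t ht => hGR ω hω t (hsub ht)) (fun ψ => (ih _).trans (h0 ψ)) φ
      rw [hdef, ← mul_div_assoc, div_lt_one hn0]
      exact hn
  simpa [hnh] using key n le_rfl φ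

end flow

section gaussian

theorem hasLineDerivAt_eval_mvPolynomial {ι : Type*} [DecidableEq ι] (φ : MvPolynomial ι ℝ)
    (x : ι → ℝ) (i : ι) :
    HasLineDerivAt ℝ (fun y => MvPolynomial.eval y φ)
      (MvPolynomial.eval x (MvPolynomial.pderiv i φ)) x (Pi.single i 1) := by
  have h := hasDerivWithinAt_eval_mvPolynomial (b := Pi.single i 1) (s := Set.univ) (t := 0)
    (x := fun u => x + u • Pi.single i 1) (fun j => ?_) φ
  · rw [hasDerivWithinAt_univ] at h
    unfold HasLineDerivAt
    rw [MvPolynomial.pderiv_def]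
    simpa using h
  · rw [hasDerivWithinAt_univ]
    have := (((hasDerivAt_id (0 : ℝ)).mul_const ((Pi.single i 1 : ι → ℝ) j))).const_add (x j)
    refine this.congr_deriv ?_
    by_cases hij : j = i
    · subst hij; simp
    · simp [hij]

variable {ι : Type*} [Fintype ι] {b : ι → MvPolynomial ι ℝ}

theorem mkDerivation_eq_sum_mul_pderiv (ψ : MvPolynomial ι ℝ) :
    MvPolynomial.mkDerivation ℝ b ψ = ∑ i, b i * MvPolynomial.pderiv i ψ := by
  classical
  induction ψ using MvPolynomial.induction_on with
  | C a => simp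
  | add φ ψ h h' => simp [h, h', mul_add, Finset.sum_add_distrib]
  | mul_X φ i h =>
    simp only [Derivation.leibniz, smul_eq_mul, h, MvPolynomial.mkDerivation_X,
      MvPolynomial.pderiv_X, Pi.single_apply, mul_add, Finset.sum_add_distrib, Finset.mul_sum]
    congr 1
    · simp [mul_comm]
    · exact Finset.sum_congr rfl fun j _ => by ring

theorem integral_eq_zero_of_hasLineDerivAt {F F' : (ι → ℝ) → ℝ} {v : ι → ℝ}
    (hF : Integrable F) (hF' : Integrable F') (h : ∀ x, HasLineDerivAt ℝ F (F' x) x v) :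
    ∫ x, F' x = 0 := by
  have := integral_bilinear_hasLineDerivAt_right_eq_neg_left_of_integrable (μ := volume)
    (f := fun _ : ι → ℝ => (1 : ℝ)) (f' := fun _ => 0) (g := F) (g' := F') (v := v)
    (B := ContinuousLinearMap.mul ℝ ℝ)
    (by simp) (by simpa using hF') (by simpa using hF)
    (fun x _ => by simpa [HasLineDerivAt] using hasDerivAt_const (0 : ℝ) (1 : ℝ)) (fun x _ => h x)
  simpa using this

theorem integrable_continuous_mul_radial {f : (ι → ℝ) → ℝ} {w : ℝ → ℝ} {R : ℝ}
    (hf : Continuous f) (hw : Continuous w) (hwR : ∀ s, R < s → w s = 0) :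
    Integrable fun x : ι → ℝ => f x * w (∑ i, x i ^ 2) := by
  refine Continuous.integrable_of_hasCompactSupport (by fun_prop) ?_
  refine HasCompactSupport.intro (isCompact_closedBall (0 : ι → ℝ) (|R| + 1)) fun x hx => ?_
  rw [hwR, mul_zero]
  contrapose! hx
  rw [mem_closedBall_zero_iff, pi_norm_le_iff_of_nonneg (by positivity)]
  intro i
  have h1 : x i ^ 2 ≤ ∑ i, x i ^ 2 :=
    Finset.single_le_sum (f := fun i => x i ^ 2) (fun i _ => sq_nonneg _) (Finset.mem_univ i)
  rw [Real.norm_eq_abs]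
  refine abs_le_of_sq_le_sq ?_ (by positivity)
  nlinarith [abs_nonneg R, le_abs_self R]

theorem integral_mkDerivation_mul_radial (hdiv : ∑ i, MvPolynomial.pderiv i (b i) = 0)
    (henergy : ∑ i, MvPolynomial.X i * b i = 0) {w : ℝ → ℝ} {R : ℝ} (hw : ContDiff ℝ 1 w)
    (hwR : ∀ s, R ≤ s → w s = 0) (ψ : MvPolynomial ι ℝ) :
    ∫ x : ι → ℝ, MvPolynomial.eval x (MvPolynomial.mkDerivation ℝ b ψ) * w (∑ i, x i ^ 2) = 0 := by
  classical
  have hw' : Continuous (deriv w) := hw.continuous_deriv le_rfl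
  have hwR' : ∀ s, R < s → deriv w s = 0 := by
    intro s hs
    have : w =ᶠ[nhds s] fun _ => 0 := by
      filter_upwards [lt_mem_nhds hs] with u hu using hwR u hu.le
    rw [this.deriv_eq, deriv_const]
  have hwR0 : ∀ s, R < s → w s = 0 := fun s hs => hwR s hs.le
  have hd : ∀ i x, HasLineDerivAt ℝ
      (fun x : ι → ℝ => MvPolynomial.eval x (b i * ψ) * w (∑ j, x j ^ 2))
      (MvPolynomial.eval x (MvPolynomial.pderiv i (b i * ψ)) * w (∑ j, x j ^ 2)
        + MvPolynomial.eval x (b i * ψ * (2 * MvPolynomial.X i)) * deriv w (∑ j, x j ^ 2))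
      x (Pi.single i 1) := by
    intro i x
    have h1 := hasLineDerivAt_eval_mvPolynomial (b i * ψ) x i
    have h2 := hasLineDerivAt_eval_mvPolynomial (∑ j, MvPolynomial.X j ^ 2) x i
    have h3 : MvPolynomial.pderiv i (∑ j, MvPolynomial.X j ^ 2 : MvPolynomial ι ℝ)
        = 2 * MvPolynomial.X i := by
      simp [MvPolynomial.pderiv_X, Pi.single_apply, Derivation.leibniz_pow]
    rw [h3] at h2
    simp only [map_sum, map_pow, MvPolynomial.eval_X] at h2
    unfold HasLineDerivAt at h1 h2 ⊢
    have h4 : HasDerivAt w (deriv w (∑ j, x j ^ 2))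
        (∑ j, (x + (0 : ℝ) • (Pi.single i 1 : ι → ℝ)) j ^ 2) := by
      simpa using (hw.differentiable one_ne_zero (∑ j, x j ^ 2)).hasDerivAt
    refine (h1.fun_mul (h4.comp 0 h2)).congr_deriv ?_
    simp only [map_mul, zero_smul, add_zero, Function.comp]
    ring
  have hI : ∀ i, Integrable fun x : ι → ℝ =>
      MvPolynomial.eval x (MvPolynomial.pderiv i (b i * ψ)) * w (∑ j, x j ^ 2) := fun i =>
    integrable_continuous_mul_radial (MvPolynomial.continuous_eval _) hw.continuous hwR0
  have hI' : ∀ i, Integrable fun x : ι → ℝ =>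
      MvPolynomial.eval x (b i * ψ * (2 * MvPolynomial.X i)) * deriv w (∑ j, x j ^ 2) := fun i =>
    integrable_continuous_mul_radial (MvPolynomial.continuous_eval _) hw' hwR'
  have h0 := fun i => integral_eq_zero_of_hasLineDerivAt
    (integrable_continuous_mul_radial (MvPolynomial.continuous_eval (b i * ψ)) hw.continuous hwR0)
    ((hI i).add (hI' i)) (hd i)
  have hsum := integral_finsetSum (μ := (volume : Measure (ι → ℝ))) Finset.univ
    fun i _ => (hI i).add (hI' i)
  rw [Finset.sum_eq_zero fun i _ => h0 i] at hsum
  rw [← hsum]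
  refine integral_congr_ae (ae_of_all _ fun x => ?_)
  simp only [Pi.add_apply]
  rw [Finset.sum_add_distrib, ← Finset.sum_mul, ← Finset.sum_mul, ← map_sum, ← map_sum]
  have e1 : ∑ i, MvPolynomial.pderiv i (b i * ψ) = MvPolynomial.mkDerivation ℝ b ψ := by
    rw [mkDerivation_eq_sum_mul_pderiv]
    simp only [Derivation.leibniz, smul_eq_mul, Finset.sum_add_distrib, ← Finset.mul_sum, hdiv]
    simp
  have e2 : ∑ i, b i * ψ * (2 * MvPolynomial.X i) = 0 := by
    have : ∀ i, b i * ψ * (2 * MvPolynomial.X i) = 2 * ψ * (MvPolynomial.X i * b i) := by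
      intro; ring
    simp_rw [this]
    rw [← Finset.mul_sum, henergy, mul_zero]
  rw [e1, e2]
  simp

theorem pi_gaussianReal_eq_withDensity {v : NNReal} (hv : v ≠ 0) :
    (Measure.pi fun _ : ι => gaussianReal 0 v)
      = (volume : Measure (ι → ℝ)).withDensity fun x => ∏ i, gaussianPDF 0 v (x i) := by
  refine Measure.pi_eq fun s hs => ?_
  rw [withDensity_apply _ (MeasurableSet.univ_pi hs), volume_pi, Measure.restrict_pi_pi]
  simp_rw [gaussianPDF, ← ENNReal.ofReal_prod_of_nonneg fun i _ => gaussianPDFReal_nonneg 0 v _]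
  rw [← ofReal_integral_eq_lintegral_ofReal
      (Integrable.fintype_prod fun i => (integrable_gaussianPDFReal 0 v).restrict)
      (ae_of_all _ fun x => Finset.prod_nonneg fun i _ => gaussianPDFReal_nonneg 0 v _),
    integral_fintype_prod_eq_prod (fun _ => gaussianPDFReal 0 v),
    ENNReal.ofReal_prod_of_nonneg fun i _ =>
      integral_nonneg fun x => gaussianPDFReal_nonneg 0 v x]
  simp_rw [gaussianReal_apply_eq_integral 0 hv]

theorem integral_pi_gaussianReal {v : NNReal} (hv : v ≠ 0) (f : (ι → ℝ) → ℝ) :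
    ∫ x, f x ∂(Measure.pi fun _ : ι => gaussianReal 0 v)
      = (√(2 * Real.pi * v))⁻¹ ^ Fintype.card ι
        * ∫ x : ι → ℝ, f x * Real.exp (-(∑ i, x i ^ 2) / (2 * v)) := by
  rw [pi_gaussianReal_eq_withDensity hv, integral_withDensity_eq_integral_toReal_smul
    (by fun_prop) (ae_of_all _ fun x => ENNReal.prod_lt_top fun i _ => gaussianPDF_lt_top),
    ← integral_const_mul]
  refine integral_congr_ae (ae_of_all _ fun x => ?_)
  simp only [ENNReal.toReal_prod, toReal_gaussianPDF, gaussianPDFReal, Finset.prod_mul_distrib,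
    smul_eq_mul, Finset.prod_const, Finset.card_univ, ← Real.exp_sum, ← Finset.sum_div, sub_zero,
    Finset.sum_neg_distrib]
  ring

/-- A divergence-free polynomial field tangent to spheres integrates by parts to zero against a
centered isotropic Gaussian measure cut off radially. -/
theorem integral_mkDerivation_mul_radial_gaussian (hdiv : ∑ i, MvPolynomial.pderiv i (b i) = 0)
    (henergy : ∑ i, MvPolynomial.X i * b i = 0) {w : ℝ → ℝ} {R : ℝ} (hw : ContDiff ℝ 1 w)
    (hwR : ∀ s, R ≤ s → w s = 0) {v : NNReal} (hv : v ≠ 0) (ψ : MvPolynomial ι ℝ) :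
    ∫ x : ι → ℝ, MvPolynomial.eval x (MvPolynomial.mkDerivation ℝ b ψ) * w (∑ i, x i ^ 2)
      ∂(Measure.pi fun _ : ι => gaussianReal 0 v) = 0 := by
  rw [integral_pi_gaussianReal hv]
  have := integral_mkDerivation_mul_radial hdiv henergy
    (w := fun s => w s * Real.exp (-s / (2 * v))) (R := R) (by fun_prop)
    (fun s hs => by rw [hwR s hs, zero_mul]) ψ
  simp_rw [← mul_assoc] at this
  rw [this, mul_zero]

end gaussian
section moments

variable {ι : Type*} [Fintype ι] {b : ι → MvPolynomial ι ℝ} {T : ℝ}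

theorem sum_sq_flow_eq {x : ℝ → ι → ℝ} (henergy : ∑ i, MvPolynomial.X i * b i = 0)
    (hx : ∀ i, ∀ t ∈ Set.Icc 0 T, HasDerivWithinAt (fun u => x u i)
      (MvPolynomial.eval (x t) (b i)) (Set.Icc 0 T) t) {t : ℝ} (ht : t ∈ Set.Icc 0 T) :
    ∑ i, x t i ^ 2 = ∑ i, x 0 i ^ 2 := by
  have hd : ∀ t ∈ Set.Icc 0 T,
      HasDerivWithinAt (fun u => ∑ i, x u i ^ 2) 0 (Set.Icc 0 T) t := by
    intro t ht
    have h := HasDerivWithinAt.fun_sum (u := Finset.univ) fun i _ => (hx i t ht).fun_pow 2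
    refine h.congr_deriv ?_
    have := congrArg (MvPolynomial.eval (x t)) henergy
    simp only [map_sum, map_mul, MvPolynomial.eval_X, map_zero] at this
    simp [mul_assoc, ← Finset.mul_sum, this]
  exact constant_of_has_deriv_right_zero (fun t ht => (hd t ht).continuousWithinAt)
    (fun t ht => (hd t (Set.Ico_subset_Icc_self ht)).mono_of_mem_nhdsWithin
      (Icc_mem_nhdsGE_of_mem ht)) t ht

/-- Even moments of coordinates along a divergence-free, energy-preserving quadratic flow started
from an isotropic Gaussian are bounded by the Gaussian moments. -/
theorem lintegral_even_moment_flow_le {Ω : Type*} [MeasurableSpace Ω] {P : Measure Ω}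
    [IsProbabilityMeasure P] {X : Ω → ℝ → ι → ℝ} {v : NNReal} {K : ℝ} (hK : 0 ≤ K)
    (hb : ∀ i, MonomialBound 2 K (b i)) (hdiv : ∑ i, MvPolynomial.pderiv i (b i) = 0)
    (henergy : ∑ i, MvPolynomial.X i * b i = 0) (hv : v ≠ 0)
    (hX : ∀ ω i, ∀ t ∈ Set.Icc 0 T, HasDerivWithinAt (fun u => X ω u i)
      (MvPolynomial.eval (X ω t) (b i)) (Set.Icc 0 T) t)
    (hXm : ∀ t ∈ Set.Icc 0 T, Measurable fun ω => X ω t)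
    (hlaw : Measure.map (fun ω => X ω 0) P = Measure.pi fun _ => gaussianReal 0 v)
    {t : ℝ} (ht : t ∈ Set.Icc 0 T) (i : ι) (m : ℕ) :
    ∫⁻ ω, ENNReal.ofReal (X ω t i ^ (2 * m)) ∂P
      ≤ ∫⁻ y, ENNReal.ofReal (y ^ (2 * m)) ∂(gaussianReal 0 v) := by
  have h0T : (0 : ℝ) ∈ Set.Icc 0 T := ⟨le_rfl, ht.1.trans ht.2⟩
  set g : ℕ → ℝ → ℝ := fun n s => Real.smoothTransition (n + 1 - s) with hg
  have hg0 : ∀ n s, 0 ≤ g n s := fun n s => Real.smoothTransition.nonneg _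
  have hg1 : ∀ n s, g n s ≤ 1 := fun n s => Real.smoothTransition.le_one _
  have hgs : ∀ (n : ℕ) s, (n : ℝ) + 1 ≤ s → g n s = 0 := fun n s hs =>
    Real.smoothTransition.zero_of_nonpos (by linarith)
  have hgc : ∀ n, ContDiff ℝ 1 (g n) := fun n =>
    (Real.smoothTransition.contDiff (n := 1)).comp (contDiff_const.sub contDiff_id)
  have hXti : ∀ t ∈ Set.Icc 0 T, ∀ i, Measurable fun ω => X ω t i := fun t ht i =>
    (measurable_pi_apply i).comp (hXm t ht)
  have hgm : ∀ n, Measurable fun ω => g n (∑ i, X ω 0 i ^ 2) := fun n =>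
    (hgc n).continuous.measurable.comp
      (Finset.measurable_sum _ fun i _ => (hXti 0 h0T i).pow_const 2)
  have hlim : ∀ ω, Filter.Tendsto
      (fun n => ENNReal.ofReal (X ω t i ^ (2 * m) * g n (∑ i, X ω 0 i ^ 2))) Filter.atTop
      (nhds (ENNReal.ofReal (X ω t i ^ (2 * m)))) := by
    intro ω
    refine tendsto_const_nhds.congr' ?_
    obtain ⟨n, hn⟩ := exists_nat_ge (∑ i, X ω 0 i ^ 2)
    filter_upwards [Filter.eventually_ge_atTop n] with k hk
    have : (n : ℝ) ≤ k := by exact_mod_cast hk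
    rw [hg]
    simp only
    rw [Real.smoothTransition.one_of_one_le (by linarith), mul_one]
  have hbound : ∀ n, ∫⁻ ω, ENNReal.ofReal (X ω t i ^ (2 * m) * g n (∑ i, X ω 0 i ^ 2)) ∂P
      ≤ ∫⁻ y, ENNReal.ofReal (y ^ (2 * m)) ∂(gaussianReal 0 v) := by
    intro n
    have hR : ∀ ω, g n (∑ i, X ω 0 i ^ 2) ≠ 0 → ∀ t ∈ Set.Icc 0 T, ∀ i,
        |X ω t i| ≤ (n : ℝ) + 1 := by
      intro ω hω t ht i
      have h1 : ∑ i, X ω 0 i ^ 2 < n + 1 := by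
        by_contra! hcon
        exact hω (hgs n _ hcon)
      rw [← sum_sq_flow_eq henergy (hX ω) ht] at h1
      have h2 : X ω t i ^ 2 ≤ ∑ i, X ω t i ^ 2 :=
        Finset.single_le_sum (f := fun i => X ω t i ^ 2) (fun i _ => sq_nonneg _)
          (Finset.mem_univ i)
      refine abs_le_of_sq_le_sq ?_ (by positivity)
      nlinarith [(Nat.cast_nonneg n : (0 : ℝ) ≤ n)]
    have hpow : ∀ y : ℝ, 0 ≤ y ^ (2 * m) := fun y => (even_two_mul m).pow_nonneg y
    have hgcont : Continuous fun x : ι → ℝ => g n (∑ i, x i ^ 2) :=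
      (hgc n).continuous.comp (by fun_prop)
    have hmom := integral_eval_flow_eq (P := P) hK hb (R := n + 1) (by simp) hX hXm (hgm n)
      (fun ω => by rw [abs_of_nonneg (hg0 _ _)]; exact hg1 _ _) hR (fun ψ => by
        have h := integral_mkDerivation_mul_radial_gaussian hdiv henergy (hgc n) (hgs n) hv ψ
        rw [← hlaw, integral_map (hXm 0 h0T).aemeasurable] at h
        · exact h
        · exact Continuous.aestronglyMeasurable ((MvPolynomial.continuous_eval _).mul hgcont))
      ht (MvPolynomial.X i ^ (2 * m))
    simp only [map_pow, MvPolynomial.eval_X] at hmom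
    rw [← ofReal_integral_eq_lintegral_ofReal _ (ae_of_all _ fun ω =>
      mul_nonneg (hpow _) (hg0 _ _)), hmom]
    · rw [integral_eq_lintegral_of_nonneg_ae (ae_of_all _ fun ω => mul_nonneg (hpow _) (hg0 _ _))
        (((hXti 0 h0T i).pow_const _).mul (hgm n)).aestronglyMeasurable]
      refine ENNReal.ofReal_toReal_le.trans ?_
      rw [← (measurePreserving_eval (fun _ : ι => gaussianReal 0 v) i).map_eq, ← hlaw,
        Measure.map_map (measurable_pi_apply i) (hXm 0 h0T),
        lintegral_map (by fun_prop) ((measurable_pi_apply i).comp (hXm 0 h0T))]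
      exact lintegral_mono fun ω => ENNReal.ofReal_le_ofReal
        (mul_le_of_le_one_right (hpow _) (hg1 _ _))
    · refine Integrable.of_bound (C := ((n : ℝ) + 1) ^ (2 * m))
        (((hXti t ht i).pow_const _).mul (hgm n)).aestronglyMeasurable (ae_of_all _ fun ω => ?_)
      by_cases hω : g n (∑ i, X ω 0 i ^ 2) = 0
      · rw [hω, mul_zero, norm_zero]; positivity
      · rw [Real.norm_eq_abs, abs_mul, abs_pow, abs_of_nonneg (hg0 _ _)]
        exact (mul_le_of_le_one_right (by positivity) (hg1 _ _)).trans
          (pow_le_pow_left₀ (abs_nonneg _) (hR ω hω t ht i) _)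
  calc _ = ∫⁻ ω, Filter.liminf (fun n =>
        ENNReal.ofReal (X ω t i ^ (2 * m) * g n (∑ i, X ω 0 i ^ 2))) Filter.atTop ∂P :=
        lintegral_congr fun ω => (hlim ω).liminf_eq.symm
    _ ≤ Filter.liminf (fun n =>
        ∫⁻ ω, ENNReal.ofReal (X ω t i ^ (2 * m) * g n (∑ i, X ω 0 i ^ 2)) ∂P) Filter.atTop :=
        lintegral_liminf_le fun n =>
          ENNReal.measurable_ofReal.comp (((hXti t ht i).pow_const (2 * m)).mul (hgm n))
    _ ≤ _ := Filter.liminf_le_of_le (by isBoundedDefault) fun a ha => by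
        obtain ⟨n, hn⟩ := ha.exists
        exact hn.trans (hbound n)

end moments

section shell

variable {lam T r : ℝ} {N : ℕ}

/-- The coordinate polynomial of the `m`-th component, `0` for `m = 0` and for `m > N`. -/
noncomputable def shellVar (N m : ℕ) : MvPolynomial (Fin N) ℝ :=
  if h : 1 ≤ m ∧ m ≤ N then MvPolynomial.X ⟨m - 1, by omega⟩ else 0

/-- The vector field of the `N`-dimensional shell model as a polynomial field. -/
noncomputable def shellField (lam : ℝ) (N : ℕ) (i : Fin N) : MvPolynomial (Fin N) ℝ :=
  MvPolynomial.C (shellK lam N (i + 1)) * shellVar N i ^ 2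
    - MvPolynomial.C (shellK lam N (i + 2)) * shellVar N (i + 1) * shellVar N (i + 2)
    - MvPolynomial.C (shellK lam N (i + 1)) * shellVar N (i + 2) ^ 2
    + MvPolynomial.C (shellK lam N i) * shellVar N i * shellVar N (i + 1)

theorem X_eq_shellVar (i : Fin N) : MvPolynomial.X i = shellVar N (i + 1) := by
  rw [shellVar, dif_pos ⟨by omega, i.2⟩]
  simp

theorem pderiv_shellVar (i : Fin N) (m : ℕ) :
    MvPolynomial.pderiv i (shellVar N m) = if m = i + 1 then 1 else 0 := by
  unfold shellVar
  split_ifs with h h' h'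
  · subst h'; simp
  · rw [MvPolynomial.pderiv_X_of_ne]
    intro h''
    exact h' (by rw [← h'']; simp; omega)
  · exact absurd ⟨by omega, by have := i.2; omega⟩ h
  · simp

theorem sum_pderiv_shellField :
    ∑ i, MvPolynomial.pderiv i (shellField lam N i) = 0 := by
  set f : ℕ → MvPolynomial (Fin N) ℝ := fun m => MvPolynomial.C (shellK lam N m) * shellVar N m
  have hf0 : f 0 = 0 := by simp [f, shellK]
  have hf1 : f 1 = 0 := by simp [f, shellK]
  have hfN : f N = 0 := by simp [f, shellK]
  have hfN1 : f (N + 1) = 0 := by simp [f, shellK]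
  have key : ∀ i : Fin N, MvPolynomial.pderiv i (shellField lam N i)
      = (f i + f (i + 1)) - (f (i + 1) + f (i + 2)) := by
    intro i
    simp only [shellField, map_add, map_sub, Derivation.leibniz, Derivation.leibniz_pow,
      MvPolynomial.derivation_C, pderiv_shellVar, smul_eq_mul, f]
    simp
    ring
  rw [Finset.sum_congr rfl fun i _ => key i,
    Fin.sum_univ_eq_sum_range (fun i => (f i + f (i + 1)) - (f (i + 1) + f (i + 2))),
    Finset.sum_range_sub' (fun i => f i + f (i + 1))]
  simp [hf0, hf1, hfN, hfN1]

theorem sum_X_mul_shellField : ∑ i, MvPolynomial.X i * shellField lam N i = 0 := by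
  set f : ℕ → MvPolynomial (Fin N) ℝ := fun m =>
    MvPolynomial.C (shellK lam N m) * shellVar N m * shellVar N (m + 1) ^ 2
    + MvPolynomial.C (shellK lam N (m + 1)) * shellVar N m ^ 2 * shellVar N (m + 1)
  have hf0 : f 0 = 0 := by simp [f, shellK]
  have hfN : f N = 0 := by simp [f, shellK]
  have key : ∀ i : Fin N, MvPolynomial.X i * shellField lam N i = f i - f (i + 1) := by
    intro i
    rw [X_eq_shellVar, shellField]
    simp only [f]
    ring
  rw [Finset.sum_congr rfl fun i _ => key i, Fin.sum_univ_eq_sum_range (fun i => f i - f (i + 1)),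
    Finset.sum_range_sub' f, hf0, hfN, sub_zero]

theorem exists_monomialBound_shellField (lam : ℝ) (N : ℕ) :
    ∃ K, 0 ≤ K ∧ ∀ i, MonomialBound 2 K (shellField lam N i) := by
  have hY : ∀ m, MonomialBound 1 1 (shellVar N m) := by
    intro m
    unfold shellVar
    split_ifs with h
    · simpa using MonomialBound.mul_X 0 1 1 (⟨m - 1, by omega⟩ : Fin N)
        (by simpa using MonomialBound.const (ι := Fin N) 0 1 1 (by simp))
    · simpa using MonomialBound.const (ι := Fin N) 1 1 0 (by simp)
  have hYY : ∀ (a : ℝ) m l, MonomialBound 2 |a|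
      (MvPolynomial.C a * shellVar N m * shellVar N l) := by
    intro a m l
    simpa using ((MonomialBound.const (ι := Fin N) 0 |a| a le_rfl).mul (hY m)).mul (hY l)
  have : ∀ i, ∃ K, MonomialBound 2 K (shellField lam N i) := by
    intro i
    refine ⟨|shellK lam N (i + 1)| + |-shellK lam N (i + 2)| + |-shellK lam N (i + 1)|
      + |shellK lam N i|, ?_⟩
    convert MonomialBound.add _ _ _ _ _ (MonomialBound.add _ _ _ _ _ (MonomialBound.add _ _ _ _ _
      (hYY (shellK lam N (i + 1)) i i) (hYY (-shellK lam N (i + 2)) (i + 1) (i + 2)))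
      (hYY (-shellK lam N (i + 1)) (i + 2) (i + 2))) (hYY (shellK lam N i) i (i + 1)) using 1
    simp only [shellField, map_neg]
    ring
  choose K hK using this
  obtain ⟨M, hM⟩ := (Set.finite_range K).bddAbove
  exact ⟨max M 0, le_max_right _ _, fun i =>
    (hK i).mono_const ((hM ⟨i, rfl⟩).trans (le_max_left _ _))⟩

theorem eval_shellVar {x : ℕ → ℝ} (h0 : x 0 = 0) (hN : ∀ n, N < n → x n = 0) (m : ℕ) :
    MvPolynomial.eval (fun i : Fin N => x (i + 1)) (shellVar N m) = x m := by
  unfold shellVar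
  split_ifs with h
  · simp [Nat.sub_add_cancel h.1]
  · rcases Nat.eq_zero_or_pos m with rfl | hm
    · simp [h0]
    · simp [hN m (by omega)]

theorem IsNFiniteRandomSolution.lintegral_even_moment_le {Ω : Type*} [MeasurableSpace Ω]
    {P : Measure Ω} [IsProbabilityMeasure P] {U : Ω → ℝ → ℕ → ℝ} (hr : 0 < r)
    (hU : IsNFiniteRandomSolution lam T r N P U) {t : ℝ} (ht : t ∈ Set.Icc 0 T) (n : ℕ)
    {m : ℕ} (hm : m ≠ 0) :
    ∫⁻ ω, ENNReal.ofReal (U ω t n ^ (2 * m)) ∂P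
      ≤ ∫⁻ y, ENNReal.ofReal (y ^ (2 * m)) ∂(gaussianReal 0 (r ^ 2).toNNReal) := by
  obtain ⟨hmeas, hfin, hsol, hlaw⟩ := hU
  by_cases hn : 1 ≤ n ∧ n ≤ N
  · obtain ⟨K, hK, hb⟩ := exists_monomialBound_shellField lam N
    have h := lintegral_even_moment_flow_le (P := P) (T := T)
      (X := fun ω t (i : Fin N) => U ω t (i + 1)) hK hb sum_pderiv_shellField
      sum_X_mul_shellField (v := (r ^ 2).toNNReal) (by simpa using hr.ne') ?_ ?_ hlaw ht
      ⟨n - 1, by omega⟩ m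
    · simpa only [Nat.sub_add_cancel hn.1] using h
    · intro ω i t ht
      refine ((hsol ω).2.2 (i + 1) (by omega) i.2 t ht).congr_deriv ?_
      simp only [shellField, map_add, map_sub, map_mul, map_pow, MvPolynomial.eval_C,
        eval_shellVar ((hsol ω).1 t) (hfin ω t)]
      simp
    · intro t _
      refine measurable_pi_lambda _ fun i => ?_
      exact (measurable_pi_apply _).comp (hmeas.comp (measurable_id.prodMk measurable_const))
  · have h0 : ∀ ω, U ω t n = 0 := by
      intro ω
      rcases Nat.eq_zero_or_pos n with rfl | h
      · exact (hsol ω).1 t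
      · exact hfin ω t n (by omega)
    simp [h0, hm]

theorem Hnorm_sq_eq_sum {s : ℝ} {x : ℕ → ℝ} (hlam : 0 < lam) (hx : ∀ n, N < n → x n = 0) :
    Hnorm lam s x ^ 2
      = ∑ n ∈ Finset.range N, lam ^ (2 * s * ((n : ℝ) + 1)) * x (n + 1) ^ 2 := by
  unfold Hnorm
  rw [tsum_eq_sum (s := Finset.range N), Real.sq_sqrt]
  · exact Finset.sum_nonneg fun n _ => by positivity
  · intro n hn
    rw [hx (n + 1) (by simpa [Nat.lt_succ_iff] using hn)]
    simp

theorem shellK_nonneg (hlam : 0 < lam) (n : ℕ) : 0 ≤ shellK lam N n := by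
  unfold shellK
  split_ifs <;> positivity

theorem shellK_le (hlam : 1 < lam) {n m : ℕ} (h : n ≤ m) : shellK lam N n ≤ lam ^ m := by
  unfold shellK
  split_ifs
  · exact pow_le_pow_right₀ hlam.le h
  · positivity

theorem sq_shell_vectorField_le {k₀ k₁ k₂ k a b c : ℝ} (h₀ : 0 ≤ k₀) (h₁ : 0 ≤ k₁) (h₂ : 0 ≤ k₂)
    (h₀' : k₀ ≤ k) (h₁' : k₁ ≤ k) (h₂' : k₂ ≤ k) :
    (k₁ * a ^ 2 - k₂ * b * c - k₁ * c ^ 2 + k₀ * a * b) ^ 2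
      ≤ 12 * k ^ 2 * (a ^ 4 + b ^ 4 + c ^ 4) := by
  have hk : 0 ≤ k := h₀.trans h₀'
  have ha := sq_nonneg a
  have hb := sq_nonneg b
  have hc := sq_nonneg c
  have e1 : k₁ * a ^ 2 ≤ k * a ^ 2 := by gcongr
  have e2 : k₁ * c ^ 2 ≤ k * c ^ 2 := by gcongr
  have e1' : 0 ≤ k₁ * a ^ 2 := by positivity
  have e2' : 0 ≤ k₁ * c ^ 2 := by positivity
  have e3 : |k₂ * b * c| ≤ k * (b ^ 2 + c ^ 2) := by
    rw [mul_assoc, abs_mul, abs_of_nonneg h₂]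
    refine mul_le_mul h₂' ?_ (abs_nonneg _) hk
    exact abs_le.2 ⟨by nlinarith [sq_nonneg (b + c)], by nlinarith [sq_nonneg (b - c)]⟩
  have e4 : |k₀ * a * b| ≤ k * (a ^ 2 + b ^ 2) := by
    rw [mul_assoc, abs_mul, abs_of_nonneg h₀]
    refine mul_le_mul h₀' ?_ (abs_nonneg _) hk
    exact abs_le.2 ⟨by nlinarith [sq_nonneg (a + b)], by nlinarith [sq_nonneg (a - b)]⟩
  obtain ⟨e3, e3'⟩ := abs_le.1 e3
  obtain ⟨e4, e4'⟩ := abs_le.1 e4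
  have ka : 0 ≤ k * a ^ 2 := by positivity
  have kb : 0 ≤ k * b ^ 2 := by positivity
  have kc : 0 ≤ k * c ^ 2 := by positivity
  have hle : (k₁ * a ^ 2 - k₂ * b * c - k₁ * c ^ 2 + k₀ * a * b) ^ 2
      ≤ (2 * k * (a ^ 2 + b ^ 2 + c ^ 2)) ^ 2 :=
    sq_le_sq' (by linarith) (by linarith)
  refine hle.trans ?_
  have h3 : (a ^ 2 + b ^ 2 + c ^ 2) ^ 2 ≤ 3 * (a ^ 4 + b ^ 4 + c ^ 4) := by
    nlinarith [sq_nonneg (a ^ 2 - b ^ 2), sq_nonneg (b ^ 2 - c ^ 2), sq_nonneg (a ^ 2 - c ^ 2)]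
  calc _ = 4 * k ^ 2 * (a ^ 2 + b ^ 2 + c ^ 2) ^ 2 := by ring
    _ ≤ 4 * k ^ 2 * (3 * (a ^ 4 + b ^ 4 + c ^ 4)) := by gcongr
    _ = _ := by ring

theorem rpow_shell_weight_le {s : ℝ} (hlam : 1 < lam) (hs : s < -1) (n : ℕ) :
    lam ^ (2 * s * ((n : ℝ) + 1)) * (lam ^ (n + 2)) ^ 2 ≤ lam ^ 2 * (lam ^ (2 * s + 2)) ^ n := by
  have h0 : 0 < lam := by linarith
  rw [← Real.rpow_natCast (lam ^ (2 * s + 2)), ← Real.rpow_mul h0.le, ← pow_mul,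
    ← Real.rpow_natCast lam, ← Real.rpow_natCast lam 2, ← Real.rpow_add h0, ← Real.rpow_add h0]
  refine Real.rpow_le_rpow_of_exponent_le hlam.le ?_
  push_cast
  linarith

theorem Hnorm_sq_le {s : ℝ} {x : ℕ → ℝ} (hlam : 1 < lam) (hs : s < -1)
    (hx : ∀ n, N < n → x n = 0) :
    Hnorm lam s x ^ 2 ≤ 12 * lam ^ 2 * ∑ n ∈ Finset.range N, (lam ^ (2 * s + 2)) ^ n *
      (1 + x n ^ 4 + x (n + 1) ^ 4 + x (n + 2) ^ 4) := by
  have h0 : 0 < lam := by linarith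
  rw [Hnorm_sq_eq_sum h0 hx, Finset.mul_sum]
  refine Finset.sum_le_sum fun n _ => ?_
  have h1 : x (n + 1) ^ 2 ≤ 1 + x n ^ 4 + x (n + 1) ^ 4 + x (n + 2) ^ 4 := by
    nlinarith [sq_nonneg (x (n + 1) ^ 2 - 1), sq_nonneg (x n ^ 2), sq_nonneg (x (n + 2) ^ 2),
      sq_nonneg (x (n + 1) ^ 2)]
  have h2 : lam ^ (2 * s * ((n : ℝ) + 1)) ≤ lam ^ 2 * (lam ^ (2 * s + 2)) ^ n :=
    (le_mul_of_one_le_right (by positivity)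
      (one_le_pow₀ (one_le_pow₀ hlam.le))).trans (rpow_shell_weight_le hlam hs n)
  calc _ ≤ lam ^ 2 * (lam ^ (2 * s + 2)) ^ n * (1 + x n ^ 4 + x (n + 1) ^ 4 + x (n + 2) ^ 4) := by
        gcongr
    _ ≤ 12 * (lam ^ 2 * (lam ^ (2 * s + 2)) ^ n *
        (1 + x n ^ 4 + x (n + 1) ^ 4 + x (n + 2) ^ 4)) :=
        le_mul_of_one_le_left (by positivity) (by norm_num)
    _ = _ := by ring

theorem Hnorm_timeDeriv_sq_le {s : ℝ} {X : ℝ → ℕ → ℝ} (hlam : 1 < lam) (hs : s < -1) (hT : 0 < T)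
    (hX : IsShellSolution lam N T X) {t : ℝ} (ht : t ∈ Set.Icc 0 T) :
    Hnorm lam s (timeDeriv T N X t) ^ 2 ≤ 12 * lam ^ 2 * ∑ n ∈ Finset.range N,
      (lam ^ (2 * s + 2)) ^ n * (1 + X t n ^ 4 + X t (n + 1) ^ 4 + X t (n + 2) ^ 4) := by
  have h0 : 0 < lam := by linarith
  have hN : ∀ n, N < n → timeDeriv T N X t n = 0 := fun n hn => if_neg (by omega)
  rw [Hnorm_sq_eq_sum h0 hN, Finset.mul_sum]
  refine Finset.sum_le_sum fun n hn => ?_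
  rw [Finset.mem_range] at hn
  have hd : timeDeriv T N X t (n + 1) = _ :=
    (if_pos ⟨by omega, by omega⟩).trans ((hX.2.2 (n + 1) (by omega) (by omega) t ht).derivWithin
      (uniqueDiffOn_Icc hT t ht))
  rw [hd]
  simp only [Nat.add_sub_cancel]
  have hsq := sq_shell_vectorField_le (shellK_nonneg (N := N) h0 n)
    (shellK_nonneg (N := N) h0 (n + 1)) (shellK_nonneg (N := N) h0 (n + 2))
    (shellK_le hlam (show n ≤ n + 2 by omega)) (shellK_le hlam (show n + 1 ≤ n + 2 by omega))
    (shellK_le hlam (le_refl (n + 2))) (a := X t n) (b := X t (n + 1)) (c := X t (n + 2))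
  calc _ ≤ lam ^ (2 * s * ((n : ℝ) + 1)) *
        (12 * (lam ^ (n + 2)) ^ 2 * (X t n ^ 4 + X t (n + 1) ^ 4 + X t (n + 2) ^ 4)) := by
        gcongr
    _ = lam ^ (2 * s * ((n : ℝ) + 1)) * (lam ^ (n + 2)) ^ 2 *
        (12 * (X t n ^ 4 + X t (n + 1) ^ 4 + X t (n + 2) ^ 4)) := by ring
    _ ≤ lam ^ 2 * (lam ^ (2 * s + 2)) ^ n *
        (12 * (1 + X t n ^ 4 + X t (n + 1) ^ 4 + X t (n + 2) ^ 4)) :=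
        mul_le_mul (rpow_shell_weight_le hlam hs n) (by linarith) (by positivity) (by positivity)
    _ = _ := by ring

theorem one_add_pow_le {a b c : ℝ} (ha : 0 ≤ a) (hb : 0 ≤ b) (hc : 0 ≤ c) (m : ℕ) :
    (1 + a + b + c) ^ m ≤ 4 ^ m * (1 + a ^ m + b ^ m + c ^ m) := by
  have hpa := pow_nonneg ha m
  have hpb := pow_nonneg hb m
  have hpc := pow_nonneg hc m
  have key : ∀ d, 0 ≤ d → 1 ≤ d → a ≤ d → b ≤ d → c ≤ d →
      d ^ m ≤ 1 + a ^ m + b ^ m + c ^ m →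
      (1 + a + b + c) ^ m ≤ 4 ^ m * (1 + a ^ m + b ^ m + c ^ m) := by
    intro d hd h1 h2 h3 h4 h
    calc _ ≤ (4 * d) ^ m := by gcongr; linarith
      _ = 4 ^ m * d ^ m := mul_pow _ _ _
      _ ≤ _ := by gcongr
  have hd : max (max 1 a) (max b c) = 1 ∨ max (max 1 a) (max b c) = a ∨
      max (max 1 a) (max b c) = b ∨ max (max 1 a) (max b c) = c := by grind
  refine key (max (max 1 a) (max b c)) (by simp) (by simp) (by simp) (by simp) (by simp) ?_
  rcases hd with h | h | h | h <;> rw [h] <;> first | (rw [one_pow]; linarith) | linarith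

theorem rpow_le_of_sq_le_geom_sum {q H D p : ℝ} {A : ℕ → ℝ} {m : ℕ} (hq0 : 0 < q) (hq1 : q < 1)
    (hN : 1 ≤ N) (hA : ∀ n, 0 ≤ A n) (hH : 0 ≤ H) (hD : 0 ≤ D) (hp : 0 < p) (hpm : p ≤ 2 * m)
    (h : H ^ 2 ≤ D * ∑ n ∈ Finset.range N, q ^ n * A n) :
    H ^ p ≤ 1 + (D * (1 - q)⁻¹) ^ m * ∑ n ∈ Finset.range N, q ^ n * A n ^ m := by
  have hsum : 0 ≤ ∑ n ∈ Finset.range N, q ^ n * A n ^ m :=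
    Finset.sum_nonneg fun n _ => mul_nonneg (by positivity) (pow_nonneg (hA n) m)
  have h1q : 0 < 1 - q := by linarith
  rcases le_total H 1 with hH1 | hH1
  · have := Real.rpow_le_one hH hH1 hp.le
    have : 0 ≤ (D * (1 - q)⁻¹) ^ m * ∑ n ∈ Finset.range N, q ^ n * A n ^ m := by positivity
    linarith
  have hle : H ^ p ≤ (H ^ 2) ^ m := by
    rw [← pow_mul, ← Real.rpow_natCast]
    exact Real.rpow_le_rpow_of_exponent_le hH1 (by exact_mod_cast hpm)
  set V := ∑ n ∈ Finset.range N, q ^ n with hV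
  have hV1 : 1 ≤ V := by
    have := Finset.single_le_sum (f := fun n => q ^ n) (fun n _ => by positivity)
      (Finset.mem_range.2 (show 0 < N by omega))
    simpa using this
  have hV2 : V ≤ (1 - q)⁻¹ := by
    rw [← tsum_geometric_of_lt_one hq0.le hq1]
    exact (summable_geometric_of_lt_one hq0.le hq1).sum_le_tsum _ fun n _ => by positivity
  have hV0 : 0 < V := by linarith
  have hjensen := Real.pow_arith_mean_le_arith_mean_pow (Finset.range N) (fun n => q ^ n / V) A
    (fun n _ => by positivity) (by rw [← Finset.sum_div, div_self hV0.ne']) (fun n _ => hA n) m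
  simp_rw [div_mul_eq_mul_div, ← Finset.sum_div] at hjensen
  have hpow : (∑ n ∈ Finset.range N, q ^ n * A n) ^ m
      ≤ (1 - q)⁻¹ ^ m * ∑ n ∈ Finset.range N, q ^ n * A n ^ m := by
    rw [div_pow, div_le_iff₀ (by positivity)] at hjensen
    refine hjensen.trans ?_
    rw [mul_comm]
    gcongr
    exact div_le_self hsum hV1
  calc H ^ p ≤ (H ^ 2) ^ m := hle
    _ ≤ (D * ∑ n ∈ Finset.range N, q ^ n * A n) ^ m := by gcongr
    _ = D ^ m * (∑ n ∈ Finset.range N, q ^ n * A n) ^ m := mul_pow _ _ _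
    _ ≤ D ^ m * ((1 - q)⁻¹ ^ m * ∑ n ∈ Finset.range N, q ^ n * A n ^ m) := by gcongr
    _ = (D * (1 - q)⁻¹) ^ m * ∑ n ∈ Finset.range N, q ^ n * A n ^ m := by
      rw [mul_pow, mul_assoc]
    _ ≤ _ := by linarith

end shell

section tightness

theorem lintegral_ofReal_pow_gaussianReal_lt_top (v : NNReal) (m : ℕ) :
    ∫⁻ y, ENNReal.ofReal (y ^ (2 * m)) ∂(gaussianReal 0 v) < ⊤ := by
  have h : Integrable (fun y : ℝ => y ^ (2 * m)) (gaussianReal 0 v) := by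
    have := (memLp_id_gaussianReal (μ := 0) (v := v) ((2 * m : ℕ) : NNReal)).integrable_norm_pow'
    refine this.mono' (by fun_prop) (ae_of_all _ fun y => ?_)
    simp
  exact h.lintegral_lt_top

theorem measure_interval_integral_rpow_gt {Ω : Type*} [MeasurableSpace Ω] {P : Measure Ω}
    [IsProbabilityMeasure P] {T Q ε p : ℝ} (hT : 0 < T) (hQ : 0 < Q) (hε : 0 < ε) (hp : 0 < p)
    {F B : Ω → ℝ → ℝ} (hF : ∀ ω t, 0 ≤ F ω t) (hB : Measurable fun z : Ω × ℝ => B z.1 z.2)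
    (hFB : ∀ ω, ∀ t ∈ Set.Icc 0 T, F ω t ≤ B ω t)
    (hBQ : ∀ t ∈ Set.Icc 0 T, ∫⁻ ω, ENNReal.ofReal (B ω t) ∂P ≤ ENNReal.ofReal Q) :
    1 - ε < (P {ω | (∫ t in (0 : ℝ)..T, F ω t) ^ (1 / p) ≤ (2 * T * Q / ε) ^ (1 / p)}).toReal := by
  have hL : 0 < 2 * T * Q / ε := by positivity
  set Y : Ω → ENNReal := fun ω => ∫⁻ t in Set.Ioc 0 T, ENNReal.ofReal (B ω t) with hY
  have hYm : Measurable Y := Measurable.lintegral_prod_right (by fun_prop)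
  have hYint : ∫⁻ ω, Y ω ∂P ≤ ENNReal.ofReal (T * Q) := by
    rw [hY, lintegral_lintegral_swap (by fun_prop)]
    calc _ ≤ ∫⁻ _ in Set.Ioc 0 T, ENNReal.ofReal Q :=
          setLIntegral_mono' measurableSet_Ioc fun t ht => hBQ t (Set.Ioc_subset_Icc_self ht)
      _ = _ := by
          rw [setLIntegral_const, Real.volume_Ioc, sub_zero, mul_comm, ENNReal.ofReal_mul hT.le]
  have hbad : P {ω | ENNReal.ofReal (2 * T * Q / ε) ≤ Y ω} ≤ ENNReal.ofReal (ε / 2) := by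
    refine (meas_ge_le_lintegral_div hYm.aemeasurable (by simpa using hL)
      ENNReal.ofReal_ne_top).trans ?_
    refine (ENNReal.div_le_div_right hYint _).trans ?_
    rw [← ENNReal.ofReal_div_of_pos hL]
    refine ENNReal.ofReal_le_ofReal (le_of_eq ?_)
    field_simp
  have hgood : 1 - ε / 2 ≤ (P {ω | ENNReal.ofReal (2 * T * Q / ε) ≤ Y ω}ᶜ).toReal := by
    rw [← Measure.real, probReal_compl_eq_one_sub (measurableSet_le measurable_const hYm)]
    have := ENNReal.toReal_le_of_le_ofReal (by positivity) hbad
    rw [← Measure.real] at this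
    linarith
  refine lt_of_lt_of_le (by linarith) (hgood.trans (ENNReal.toReal_mono (measure_ne_top _ _)
    (measure_mono fun ω hω => ?_)))
  simp only [Set.mem_compl_iff, Set.mem_ofPred_eq, not_le] at hω ⊢
  rw [intervalIntegral.integral_of_le hT.le]
  refine Real.rpow_le_rpow (integral_nonneg fun t => hF ω t) ?_ (by positivity)
  refine (Real.le_norm_self _).trans ((norm_integral_le_lintegral_norm _).trans ?_)
  refine ENNReal.toReal_le_of_le_ofReal hL.le (le_trans ?_ hω.le)
  refine setLIntegral_mono' measurableSet_Ioc fun t ht => ENNReal.ofReal_le_ofReal ?_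
  rw [Real.norm_of_nonneg (hF ω t)]
  exact hFB ω t (Set.Ioc_subset_Icc_self ht)

theorem rpow_le_of_sq_le_geom_sum_pow_four {N : ℕ} {q H D p : ℝ} {x : ℕ → ℝ} {m : ℕ} (hq0 : 0 < q)
    (hq1 : q < 1) (hN : 1 ≤ N) (hH : 0 ≤ H) (hD : 0 ≤ D) (hp : 0 < p) (hpm : p ≤ 2 * m)
    (h : H ^ 2 ≤ D * ∑ n ∈ Finset.range N,
      q ^ n * (1 + x n ^ 4 + x (n + 1) ^ 4 + x (n + 2) ^ 4)) :
    H ^ p ≤ 1 + (4 * (D * (1 - q)⁻¹)) ^ m * ∑ n ∈ Finset.range N, q ^ n *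
      (1 + x n ^ (2 * (2 * m)) + x (n + 1) ^ (2 * (2 * m)) + x (n + 2) ^ (2 * (2 * m))) := by
  have h4 : ∀ n, 0 ≤ x n ^ 4 := fun n => by positivity
  refine (rpow_le_of_sq_le_geom_sum (A := fun n => 1 + x n ^ 4 + x (n + 1) ^ 4 + x (n + 2) ^ 4)
    hq0 hq1 hN (fun n => by positivity) hH hD hp hpm h).trans ?_
  have h1q : 0 < 1 - q := by linarith
  rw [mul_comm 4, mul_pow _ 4, mul_assoc _ (4 ^ m), Finset.mul_sum _ _ (4 ^ m)]
  gcongr 1 + _ * ∑ n ∈ _, ?_ with n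
  have hp4 : ∀ n, x n ^ (2 * (2 * m)) = (x n ^ 4) ^ m := fun n => by
    rw [← pow_mul]; ring_nf
  calc _ ≤ q ^ n * (4 ^ m * (1 + (x n ^ 4) ^ m + (x (n + 1) ^ 4) ^ m + (x (n + 2) ^ 4) ^ m)) := by
        gcongr
        exact one_add_pow_le (h4 _) (h4 _) (h4 _) m
    _ = _ := by
        simp only [hp4]
        ring

theorem lintegral_geom_sum_le {Ω : Type*} [MeasurableSpace Ω] {P : Measure Ω}
    [IsProbabilityMeasure P] {N : ℕ} {q c M : ℝ} {Z : Ω → ℕ → ℝ} (hq0 : 0 < q) (hq1 : q < 1)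
    (hc : 0 ≤ c) (hM : 0 ≤ M) (hZ : ∀ ω n, 0 ≤ Z ω n) (hZm : ∀ n, Measurable fun ω => Z ω n)
    (hZM : ∀ n, ∫⁻ ω, ENNReal.ofReal (Z ω n) ∂P ≤ ENNReal.ofReal M) :
    ∫⁻ ω, ENNReal.ofReal (2 + c * ∑ n ∈ Finset.range N,
        q ^ n * (1 + Z ω n + Z ω (n + 1) + Z ω (n + 2))) ∂P
      ≤ ENNReal.ofReal (2 + c * ((1 - q)⁻¹ * (1 + 3 * M))) := by
  have hInt : ∀ n, Integrable (fun ω => Z ω n) P := fun n =>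
    (lintegral_ofReal_ne_top_iff_integrable (hZm n).aestronglyMeasurable
      (ae_of_all _ fun ω => hZ ω n)).1 ((hZM n).trans_lt ENNReal.ofReal_lt_top).ne
  have hle : ∀ n, ∫ ω, Z ω n ∂P ≤ M := fun n => by
    rw [integral_eq_lintegral_of_nonneg_ae (ae_of_all _ fun ω => hZ ω n)
      (hZm n).aestronglyMeasurable]
    exact ENNReal.toReal_le_of_le_ofReal hM (hZM n)
  have hInt1 : ∀ n, Integrable (fun ω => 1 + Z ω n) P := fun n =>
    (integrable_const 1).add (hInt n)
  have hInt2 : ∀ n, Integrable (fun ω => 1 + Z ω n + Z ω (n + 1)) P := fun n =>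
    (hInt1 n).add (hInt (n + 1))
  have hInt3 : ∀ n, Integrable (fun ω => 1 + Z ω n + Z ω (n + 1) + Z ω (n + 2)) P := fun n =>
    (hInt2 n).add (hInt (n + 2))
  have hsum : Integrable (fun ω => ∑ n ∈ Finset.range N,
      q ^ n * (1 + Z ω n + Z ω (n + 1) + Z ω (n + 2))) P :=
    integrable_finsetSum _ fun n _ => (hInt3 n).const_mul _
  have h1q : 0 < 1 - q := by linarith
  have hInt4 : Integrable (fun ω => 2 + c * ∑ n ∈ Finset.range N,
      q ^ n * (1 + Z ω n + Z ω (n + 1) + Z ω (n + 2))) P :=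
    (integrable_const 2).add (hsum.const_mul c)
  rw [← ofReal_integral_eq_lintegral_ofReal hInt4
    (ae_of_all _ fun ω => add_nonneg zero_le_two (mul_nonneg hc (Finset.sum_nonneg fun n _ => by
      have := hZ ω n; have := hZ ω (n + 1); have := hZ ω (n + 2); positivity)))]
  refine ENNReal.ofReal_le_ofReal ?_
  rw [integral_add (integrable_const 2) (hsum.const_mul c), integral_const_mul,
    integral_finsetSum _ fun n _ => (hInt3 n).const_mul _]
  simp only [integral_const, probReal_univ, one_smul]
  gcongr
  calc _ ≤ ∑ n ∈ Finset.range N, q ^ n * (1 + 3 * M) := by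
        refine Finset.sum_le_sum fun n _ => ?_
        rw [integral_const_mul, integral_add (hInt2 n) (hInt _), integral_add (hInt1 n) (hInt _),
          integral_add (integrable_const 1) (hInt n)]
        simp only [integral_const, probReal_univ, one_smul]
        exact mul_le_mul_of_nonneg_left (by linarith [hle n, hle (n + 1), hle (n + 2)])
          (by positivity)
    _ ≤ _ := by
        rw [← Finset.sum_mul, ← tsum_geometric_of_lt_one hq0.le hq1]
        gcongr
        exact (summable_geometric_of_lt_one hq0.le hq1).sum_le_tsum _ fun n _ => by positivity

end tightness

/-- uniform-in-`N` bound in probability for the `W^{1,p}(0,T;H^s)` norm of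
`N`-finite random solutions: for every `s < −1`, `p > 1`, `ε > 0` there is `C_ε > 0`,
independent of `N`, with
`P( (∫_0^T (‖U(t)‖_{H^s}^p + ‖∂_t U(t)‖_{H^s}^p) dt)^{1/p} ≤ C_ε ) > 1 − ε`. -/
theorem nfinite_random_solution_W1p_bound (lam r T : ℝ) (hlam : 1 < lam) (hr : 0 < r)
    (hT : 0 < T) (s p ε : ℝ) (hs : s < -1) (hp : 1 < p) (hε : 0 < ε) :
    ∃ C : ℝ, 0 < C ∧
      ∀ (N : ℕ), 1 ≤ N → ∀ (Ω : Type*) (_ : MeasurableSpace Ω) (P : Measure Ω)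
        (_ : IsProbabilityMeasure P) (U : Ω → ℝ → ℕ → ℝ),
        IsNFiniteRandomSolution lam T r N P U →
        1 - ε <
          (P {ω |
            (∫ t in (0 : ℝ)..T,
              (Hnorm lam s (U ω t) ^ p
                + Hnorm lam s (timeDeriv T N (U ω) t) ^ p)) ^ (1 / p) ≤ C}).toReal := by
  set q : ℝ := lam ^ (2 * s + 2) with hq
  have hq0 : 0 < q := Real.rpow_pos_of_pos (by linarith) _
  have hq1 : q < 1 := Real.rpow_lt_one_of_one_lt_of_neg hlam (by linarith)
  have h1q : 0 < 1 - q := by linarith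
  obtain ⟨m, hm⟩ := exists_nat_ge p
  have hm0 : m ≠ 0 := by
    rintro rfl
    simp only [Nat.cast_zero] at hm
    linarith
  have hpm : p ≤ 2 * m := by linarith
  set M : ℝ := (∫⁻ y, ENNReal.ofReal (y ^ (2 * (2 * m)))
    ∂(gaussianReal 0 (r ^ 2).toNNReal)).toReal with hM
  have hM0 : 0 ≤ M := ENNReal.toReal_nonneg
  set c : ℝ := 2 * (4 * (12 * lam ^ 2 * (1 - q)⁻¹)) ^ m with hc
  have hc0 : 0 ≤ c := by positivity
  set Q : ℝ := 2 + c * ((1 - q)⁻¹ * (1 + 3 * M))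
  have hQ : 0 < Q := by positivity
  refine ⟨(2 * T * Q / ε) ^ (1 / p), by positivity, fun N hN Ω _ P _ U hU => ?_⟩
  have hUm : ∀ n, Measurable fun z : Ω × ℝ => U z.1 z.2 n := fun n =>
    (measurable_pi_apply n).comp hU.1
  refine measure_interval_integral_rpow_gt (B := fun ω t => 2 + c * ∑ n ∈ Finset.range N,
    q ^ n * (1 + U ω t n ^ (2 * (2 * m)) + U ω t (n + 1) ^ (2 * (2 * m))
      + U ω t (n + 2) ^ (2 * (2 * m)))) hT hQ hε (by linarith) (fun ω t => ?_) (by fun_prop)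
    (fun ω t ht => ?_) fun t ht => ?_
  · exact add_nonneg (Real.rpow_nonneg (Real.sqrt_nonneg _) _)
      (Real.rpow_nonneg (Real.sqrt_nonneg _) _)
  · have h1 := rpow_le_of_sq_le_geom_sum_pow_four hq0 hq1 hN (Real.sqrt_nonneg _)
      (by positivity) (by linarith) hpm (Hnorm_sq_le hlam hs (hU.2.1 ω t))
    have h2 := rpow_le_of_sq_le_geom_sum_pow_four hq0 hq1 hN (Real.sqrt_nonneg _)
      (by positivity) (by linarith) hpm (Hnorm_timeDeriv_sq_le hlam hs hT (hU.2.2.1 ω) ht)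
    refine (add_le_add h1 h2).trans (le_of_eq ?_)
    rw [hc]
    ring
  · refine lintegral_geom_sum_le (Z := fun ω n => U ω t n ^ (2 * (2 * m))) hq0 hq1 hc0 hM0
      (fun ω n => (even_two_mul _).pow_nonneg _) (fun n => ?_) fun n => ?_
    · exact ((hUm n).comp (measurable_id.prodMk measurable_const)).pow_const _
    · rw [hM, ENNReal.ofReal_toReal (lintegral_ofReal_pow_gaussianReal_lt_top _ _).ne]
      exact hU.lintegral_even_moment_le hr ht n (by omega)
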